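/- Among all trees with a given tree degree sequence, a greedy caterpillar attains the minimum connective eccentricity index; that is, if d̄ = (d₁,…,d_n) is a non-increasing sequence of positive integers with Σ dᵢ = 2(n−1), n ≥ 3, and T* is a greedy caterpillar with degree sequence d̄, then ξ^{ce}(T*) ≤ ξ^{ce}(T) for every tree T with degree sequence d̄. -/

import Mathlib

open Finset SimpleGraph

variable {V : Type*}

open Classical in
/-- The degree of a vertex `u` in a graph `G` (number of neighbors). -/
noncomputable def deg [Fintype V] (G : SimpleGraph V) (u : V) : ℕ :=
  (Finset.univ.filter (fun v => G.Adj u v)).card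

/-- The eccentricity of a vertex `u`: the maximum distance from `u` to any vertex. -/
noncomputable def ecc [Fintype V] (G : SimpleGraph V) (u : V) : ℕ :=
  Finset.univ.sup (fun v => G.dist u v)

/-- The connective eccentricity index `ξ^{ce}(G) = Σ_{u ∈ V} d(u)/ε(u)`. -/
noncomputable def cei [Fintype V] (G : SimpleGraph V) : ℝ :=
  ∑ u : V, (deg G u : ℝ) / (ecc G u)

/-- `G` has degree sequence `d = (d₁, …, d_n)` (up to relabeling of the vertices). -/
def hasDegSeq [Fintype V] (G : SimpleGraph V) {n : ℕ} (d : Fin n → ℕ) : Prop :=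
  ∃ e : V ≃ Fin n, ∀ v, deg G v = d (e v)

/-- `T` is a greedy caterpillar whose spine has `k` vertices (`k` = the number of
entries `> 1` in the degree sequence): there is a path `z₀ z₁ ⋯ z_{k-1}` such that
every vertex off the path is a pendant vertex, every path vertex has degree `≥ 2`
(i.e. the path vertices carry the non-leaf degrees), and whenever a path vertex has
strictly larger eccentricity *within the path* (which is `max i (k-1-i)` for `z_i`)
than another, its degree in `T` is at least as large. -/
def IsGreedyCaterpillar [Fintype V] (T : SimpleGraph V) (k : ℕ) : Prop :=
  ∃ z : Fin k ↪ V,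
    (∀ (i : ℕ) (h : i + 1 < k), T.Adj (z ⟨i, Nat.lt_of_succ_lt h⟩) (z ⟨i + 1, h⟩)) ∧
    (∀ v, v ∉ Set.range z → deg T v = 1) ∧
    (∀ i : Fin k, 2 ≤ deg T (z i)) ∧
    (∀ i j : Fin k,
      max (j : ℕ) (k - 1 - (j : ℕ)) < max (i : ℕ) (k - 1 - (i : ℕ)) →
      deg T (z j) ≤ deg T (z i))


theorem two_le_deg_iff [Fintype V] {G : SimpleGraph V} {v : V} :
    2 ≤ deg G v ↔ ∃ a b, G.Adj v a ∧ G.Adj v b ∧ a ≠ b := by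
  classical
  unfold deg
  change 1 < _ ↔ _
  rw [Finset.one_lt_card]
  simp only [Finset.mem_filter, Finset.mem_univ, true_and]
  exact ⟨fun ⟨a, ha, b, hb, h⟩ => ⟨a, b, ha, hb, h⟩, fun ⟨a, b, ha, hb, h⟩ => ⟨a, ha, b, hb, h⟩⟩

theorem eq_of_deg_eq_one [Fintype V] {G : SimpleGraph V} {v a b : V} (h : deg G v = 1)
    (ha : G.Adj v a) (hb : G.Adj v b) : a = b := by
  by_contra hab
  have := two_le_deg_iff.2 ⟨a, b, ha, hb, hab⟩
  omega

theorem dist_le_ecc [Fintype V] (G : SimpleGraph V) (u v : V) : G.dist u v ≤ ecc G u :=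
  Finset.le_sup (f := fun v => G.dist u v) (Finset.mem_univ v)

theorem exists_dist_eq_ecc [Fintype V] (G : SimpleGraph V) (u : V) :
    ∃ v, G.dist u v = ecc G u := by
  obtain ⟨v, -, hv⟩ := Finset.exists_mem_eq_sup Finset.univ ⟨u, Finset.mem_univ u⟩
    (fun v => G.dist u v)
  exact ⟨v, hv.symm⟩

theorem ecc_pos [Fintype V] [Nontrivial V] {G : SimpleGraph V} (hG : G.Connected) (u : V) :
    1 ≤ ecc G u := by
  obtain ⟨v, hv⟩ := exists_ne u
  exact (hG.pos_dist_of_ne hv.symm).trans_le (dist_le_ecc G u v)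

theorem ecc_le_ecc_add_one [Fintype V] {G : SimpleGraph V} (hG : G.Connected) {u v : V}
    (h : G.Adj u v) : ecc G u ≤ ecc G v + 1 := by
  obtain ⟨w, hw⟩ := exists_dist_eq_ecc G u
  have h1 := hG.dist_triangle (u := u) (v := v) (w := w)
  have h2 := dist_le_ecc G v w
  have h3 := dist_eq_one_iff_adj.2 h
  omega

/-- In a tree, a vertex has at most one neighbor closer to a given root. -/
theorem closer_neighbor_unique {G : SimpleGraph V} (hG : G.IsTree) (r : V) {v a b : V}
    (ha : G.Adj v a) (hb : G.Adj v b) (hda : G.dist r v = G.dist r a + 1)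
    (hdb : G.dist r v = G.dist r b + 1) : a = b := by
  obtain ⟨p, hp⟩ := hG.connected.exists_walk_length_eq_dist r a
  obtain ⟨q, hq⟩ := hG.connected.exists_walk_length_eq_dist r b
  have hp' : (p.concat ha.symm).IsPath := by
    apply Walk.isPath_of_length_eq_dist
    rw [Walk.length_concat]; omega
  have hq' : (q.concat hb.symm).IsPath := by
    apply Walk.isPath_of_length_eq_dist
    rw [Walk.length_concat]; omega
  have h := (hG.existsUnique_path r v).unique hp' hq'
  have := congrArg Walk.penultimate h
  simpa using this

/-- A parent function of a tree rooted at `r`. -/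
def IsParent (G : SimpleGraph V) (r : V) (par : V → V) : Prop :=
  ∀ v, v ≠ r → G.Adj v (par v) ∧ G.dist r v = G.dist r (par v) + 1

theorem exists_isParent {G : SimpleGraph V} (hG : G.IsTree) (r : V) :
    ∃ par, IsParent G r par := by
  have : ∀ v, ∃ u, v ≠ r → G.Adj v u ∧ G.dist r v = G.dist r u + 1 := by
    intro v
    by_cases hv : v = r
    · exact ⟨v, fun h => absurd hv h⟩
    obtain ⟨p, hp⟩ := hG.connected.exists_walk_length_eq_dist v r
    cases p with
    | nil => exact absurd rfl hv
    | @cons _ u _ h q =>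
      refine ⟨u, fun _ => ⟨h, ?_⟩⟩
      have h1 := dist_le q
      have h2 := hG.dist_eq_dist_add_one_of_adj r h
      rw [Walk.length_cons] at hp
      rw [dist_comm] at hp h1
      omega
  choose par hpar using this
  exact ⟨par, hpar⟩

theorem IsParent.eq_of_dist {G : SimpleGraph V} (hG : G.IsTree) {r : V} {par : V → V}
    (hpar : IsParent G r par) {v u : V} (h : G.Adj v u) (hd : G.dist r v = G.dist r u + 1) :
    par v = u := by
  have hv : v ≠ r := by
    rintro rfl
    simp at hd
  exact closer_neighbor_unique hG r (hpar v hv).1 h (hpar v hv).2 hd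

theorem IsParent.card_children [Fintype V] {G : SimpleGraph V} (hG : G.IsTree) {r : V}
    {par : V → V} (hpar : IsParent G r par) [DecidableEq V] (p : V) :
    ((Finset.univ.erase r).filter (fun v => par v = p)).card + (if p = r then 0 else 1)
      = deg G p := by
  classical
  have hchild : ∀ v, v ≠ r → par v = p → G.Adj p v ∧ G.dist r v = G.dist r p + 1 := by
    rintro v hv rfl
    exact ⟨(hpar v hv).1.symm, (hpar v hv).2⟩
  have hne : ∀ v, G.dist r v = G.dist r p + 1 → v ≠ r := by
    rintro v h rfl
    simp at h
  unfold deg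
  split_ifs with hp
  · subst hp
    rw [add_zero]
    congr 1
    ext v
    simp only [Finset.mem_filter, Finset.mem_erase, Finset.mem_univ, and_true, true_and]
    refine ⟨fun h => (hchild v h.1 h.2).1, fun h => ?_⟩
    have hd : G.dist p v = G.dist p p + 1 := by
      rw [dist_self, dist_eq_one_iff_adj.2 h]
    exact ⟨hne v hd, hpar.eq_of_dist hG h.symm hd⟩
  · have hnot : par p ∉ (Finset.univ.erase r).filter (fun v => par v = p) := by
      intro h
      simp only [Finset.mem_filter, Finset.mem_erase, Finset.mem_univ, and_true] at h
      have h1 := (hchild _ h.1 h.2).2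
      have h2 := (hpar p hp).2
      omega
    rw [← Finset.card_insert_of_notMem hnot]
    congr 1
    ext v
    simp only [Finset.mem_insert, Finset.mem_filter, Finset.mem_erase, Finset.mem_univ, and_true,
      true_and]
    constructor
    · rintro (rfl | h)
      · exact (hpar p hp).1
      · exact (hchild v h.1 h.2).1
    · intro h
      rcases hG.dist_eq_dist_add_one_of_adj r h with hd | hd
      · exact Or.inl (hpar.eq_of_dist hG h hd).symm
      · exact Or.inr ⟨hne v hd, hpar.eq_of_dist hG h.symm hd⟩

theorem IsParent.sum_comp [Fintype V] [DecidableEq V] {G : SimpleGraph V} (hG : G.IsTree) {r : V}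
    {par : V → V} (hpar : IsParent G r par) (F : V → ℝ) :
    ∑ v ∈ Finset.univ.erase r, F (par v) = ∑ v, ((deg G v : ℝ) - 1) * F v + F r := by
  have h1 : ∑ v ∈ Finset.univ.erase r, F (par v)
      = ∑ p, (((Finset.univ.erase r).filter (fun v => par v = p)).card : ℝ) * F p := by
    rw [← Finset.sum_fiberwise (Finset.univ.erase r) par]
    refine Finset.sum_congr rfl fun p _ => ?_
    rw [← nsmul_eq_mul, ← Finset.sum_const]
    refine Finset.sum_congr rfl fun v hv => ?_
    rw [(Finset.mem_filter.1 hv).2]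
  have h2 : F r = ∑ p, (if p = r then F p else 0) := by simp
  rw [h1, h2, ← Finset.sum_add_distrib]
  refine Finset.sum_congr rfl fun p _ => ?_
  rw [← hpar.card_children hG p]
  split_ifs <;> push_cast <;> ring

/-- Distances from a leaf run through its neighbor. -/
theorem dist_leaf [Fintype V] {G : SimpleGraph V} (hG : G.IsTree) {v u w : V} (hv : deg G v = 1)
    (h : G.Adj v u) (hw : w ≠ v) : G.dist w v = G.dist w u + 1 := by
  obtain ⟨par, hpar⟩ := exists_isParent hG w
  obtain ⟨h1, h2⟩ := hpar v hw.symm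
  rwa [eq_of_deg_eq_one hv h1 h] at h2

theorem ecc_leaf [Fintype V] {G : SimpleGraph V} (hG : G.IsTree) (hn : 3 ≤ Fintype.card V)
    {v u : V} (hv : deg G v = 1) (h : G.Adj v u) : ecc G v = ecc G u + 1 := by
  classical
  refine le_antisymm (ecc_le_ecc_add_one hG.connected h) ?_
  have key : ∃ w, w ≠ v ∧ ecc G u ≤ G.dist u w := by
    obtain ⟨w, hw⟩ := exists_dist_eq_ecc G u
    by_cases hwv : w = v
    · subst hwv
      obtain ⟨x, hx⟩ : ∃ x, x ∉ ({w, u} : Finset V) := by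
        by_contra hcon
        push Not at hcon
        have := Finset.card_le_card (fun x _ => hcon x : Finset.univ ⊆ ({w, u} : Finset V))
        have h2 := Finset.card_le_two (a := w) (b := u)
        rw [Finset.card_univ] at this
        omega
      simp only [Finset.mem_insert, Finset.mem_singleton, not_or] at hx
      refine ⟨x, hx.1, ?_⟩
      rw [← hw, dist_eq_one_iff_adj.2 h.symm]
      exact hG.connected.pos_dist_of_ne (Ne.symm hx.2)
    · exact ⟨w, hwv, hw.ge⟩
  obtain ⟨w, hwv, hw⟩ := key
  have h1 := dist_leaf hG hv h hwv
  have h2 := dist_le_ecc G v w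
  rw [dist_comm] at h2
  rw [dist_comm] at hw
  omega

/-- In a tree, a vertex on the geodesic between `a` and `b` separates every vertex from `a` or
from `b`. -/
theorem dist_add_dist_le_of_mem_support {G : SimpleGraph V} (hG : G.IsTree) {a b x : V}
    {p : G.Walk a b} (hp : p.IsPath) (hx : x ∈ p.support) (w : V) :
    G.dist w x + G.dist x a ≤ G.dist w a ∨ G.dist w x + G.dist x b ≤ G.dist w b := by
  classical
  obtain ⟨q, hq⟩ := hG.connected.exists_walk_length_eq_dist w a
  obtain ⟨s, hs⟩ := hG.connected.exists_walk_length_eq_dist w b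
  have hpe : (q.reverse.append s).bypass = p :=
    (hG.existsUnique_path a b).unique (Walk.bypass_isPath _) hp
  have hmem : x ∈ (q.reverse.append s).support :=
    Walk.support_bypass_subset_support _ (hpe ▸ hx)
  have split : ∀ {c : V} (t : G.Walk w c), x ∈ t.support →
      G.dist w x + G.dist x c ≤ t.length := by
    intro c t ht
    have h1 := dist_le (t.takeUntil x ht)
    have h2 := dist_le (t.dropUntil x ht)
    have h3 := congrArg Walk.length (t.take_spec ht)
    rw [Walk.length_append] at h3
    omega
  rw [Walk.mem_support_append_iff, Walk.support_reverse, List.mem_reverse] at hmem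
  exact hmem.imp (fun h => hq ▸ split q h) (fun h => hs ▸ split s h)

/-- A diametral path of a tree, along which the eccentricities are as small as possible. -/
theorem exists_diametral_path [Fintype V] {G : SimpleGraph V} (hG : G.IsTree) :
    ∃ (D : ℕ) (p : ℕ → V), (∀ u, ecc G u ≤ D) ∧
      (∀ i j, i ≤ D → j ≤ D → p i = p j → i = j) ∧
      (∀ i, i < D → G.Adj (p i) (p (i + 1))) ∧
      ∀ i, i ≤ D → ecc G (p i) ≤ max i (D - i) := by
  have := hG.connected.nonempty
  obtain ⟨a, -, ha⟩ := Finset.exists_max_image Finset.univ (ecc G) Finset.univ_nonempty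
  obtain ⟨b, hb⟩ := exists_dist_eq_ecc G a
  obtain ⟨p, hp⟩ := hG.connected.exists_walk_length_eq_dist a b
  have hmax : ∀ u v, G.dist u v ≤ ecc G a :=
    fun u v => (dist_le_ecc G u v).trans (ha u (Finset.mem_univ u))
  have hdist : ∀ i, i ≤ ecc G a →
      G.dist (p.getVert i) a = i ∧ G.dist (p.getVert i) b = ecc G a - i := by
    intro i hi
    have h1 := dist_le (p.take i)
    have h2 := dist_le (p.drop i)
    have h3 := hG.connected.dist_triangle (u := a) (v := p.getVert i) (w := b)
    rw [Walk.take_length] at h1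
    rw [Walk.drop_length] at h2
    rw [dist_comm (u := p.getVert i) (v := a)]
    omega
  refine ⟨ecc G a, p.getVert, fun u => ha u (Finset.mem_univ u), ?_, ?_, ?_⟩
  · intro i j hi hj h
    rw [← (hdist i hi).1, ← (hdist j hj).1, h]
  · intro i hi
    exact p.adj_getVert_succ (by omega)
  · intro i hi
    obtain ⟨w, hw⟩ := exists_dist_eq_ecc G (p.getVert i)
    have h1 := hmax w a
    have h2 := hmax w b
    have h3 := hdist i hi
    rw [dist_comm] at hw
    rcases dist_add_dist_le_of_mem_support hG (p.isPath_of_length_eq_dist hp)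
      (p.getVert_mem_support i) w with h | h <;> omega

theorem ecc_lt_of_two_le_deg [Fintype V] {G : SimpleGraph V} (hG : G.IsTree) {D : ℕ}
    (hD : ∀ u, ecc G u ≤ D) {v : V} (hv : 2 ≤ deg G v) : ecc G v + 1 ≤ D := by
  obtain ⟨a, b, ha, hb, hab⟩ := two_le_deg_iff.1 hv
  obtain ⟨w, hw⟩ := exists_dist_eq_ecc G v
  have h1 := hG.dist_eq_dist_add_one_of_adj w ha
  have h2 := hG.dist_eq_dist_add_one_of_adj w hb
  have h3 := fun h h' => hab (closer_neighbor_unique hG w ha hb h h')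
  have h4 := (dist_le_ecc G w a).trans (hD w)
  have h5 := (dist_le_ecc G w b).trans (hD w)
  rw [dist_comm] at hw
  by_contra hcon
  exact h3 (by omega) (by omega)

/-- A tree with `k` internal vertices has at least `min k (2 * j - k)` internal vertices of
eccentricity at most `j`. -/
theorem card_internal_ecc_le [Fintype V] {G : SimpleGraph V} (hG : G.IsTree) {k : ℕ}
    (hk : (Finset.univ.filter (fun v => 2 ≤ deg G v)).card = k) (j : ℕ) :
    min k (2 * j - k) ≤ (Finset.univ.filter (fun v => 2 ≤ deg G v ∧ ecc G v ≤ j)).card := by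
  classical
  obtain ⟨D, p, hD, hinj, hadj, hecc⟩ := exists_diametral_path hG
  have hint : ∀ i, 1 ≤ i → i + 1 ≤ D → 2 ≤ deg G (p i) := by
    intro i h1 h2
    refine two_le_deg_iff.2 ⟨p (i - 1), p (i + 1), ?_, hadj i h2, fun h => ?_⟩
    · have := hadj (i - 1) (by omega)
      rw [Nat.sub_add_cancel h1] at this
      exact this.symm
    · have := hinj _ _ (by omega) h2 h
      omega
  have hcard : ∀ s t, t ≤ D → ((Finset.Ico s (t + 1)).image p).card = t + 1 - s := by
    intro s t ht
    rw [Finset.card_image_of_injOn, Nat.card_Ico]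
    intro x hx y hy h
    simp only [Finset.coe_Ico, Set.mem_Ico] at hx hy
    exact hinj x y (by omega) (by omega) h
  have hDk : D - 1 ≤ k := by
    have := hcard 1 (D - 1) (by omega)
    rw [← hk]
    refine le_trans (by omega) (this.symm.le.trans (Finset.card_le_card ?_))
    intro x hx
    obtain ⟨i, hi, rfl⟩ := Finset.mem_image.1 hx
    rw [Finset.mem_Ico] at hi
    exact Finset.mem_filter.2 ⟨Finset.mem_univ _, hint i (by omega) (by omega)⟩
  by_cases hj : D ≤ j + 1
  · refine (min_le_left _ _).trans (hk.symm.le.trans (Finset.card_le_card ?_))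
    intro x hx
    have hx' := (Finset.mem_filter.1 hx).2
    have := ecc_lt_of_two_le_deg hG hD hx'
    exact Finset.mem_filter.2 ⟨Finset.mem_univ _, hx', by omega⟩
  · have := hcard (D - j) j (by omega)
    refine (min_le_right _ _).trans (le_trans (by omega)
      (this.symm.le.trans (Finset.card_le_card ?_)))
    intro x hx
    obtain ⟨i, hi, rfl⟩ := Finset.mem_image.1 hx
    rw [Finset.mem_Ico] at hi
    have := hecc i (by omega)
    exact Finset.mem_filter.2 ⟨Finset.mem_univ _, hint i (by omega) (by omega), by omega⟩

/-- Abel summation along the level sets of `a`. -/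
theorem sum_mul_eq_layer_sum {ι : Type*} [Fintype ι] (a : ι → ℕ) (w : ι → ℝ) (g : ℕ → ℝ) {M : ℕ}
    (hM : ∀ i, a i ≤ M) :
    ∑ i, w i * g (a i) = g M * ∑ i, w i +
      ∑ j ∈ Finset.range M, (g j - g (j + 1)) * ∑ i ∈ Finset.univ.filter (fun i => a i ≤ j), w i := by
  have hg : ∀ n m, n ≤ m →
      g n = g m + ∑ j ∈ Finset.range m, if n ≤ j then g j - g (j + 1) else 0 := by
    intro n m hnm
    induction m, hnm using Nat.le_induction with
    | base =>
      rw [Finset.sum_eq_zero, add_zero]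
      intro j hj
      rw [if_neg (by rw [Finset.mem_range] at hj; omega)]
    | succ m hm ih =>
      rw [Finset.sum_range_succ, if_pos hm, ih]
      ring
  have h1 : ∀ i, w i * g (a i) = g M * w i +
      ∑ j ∈ Finset.range M, (g j - g (j + 1)) * (if a i ≤ j then w i else 0) := by
    intro i
    rw [hg (a i) M (hM i), mul_add, Finset.mul_sum, mul_comm]
    congr 1
    refine Finset.sum_congr rfl fun j _ => ?_
    split_ifs <;> ring
  rw [Finset.sum_congr rfl fun i _ => h1 i, Finset.sum_add_distrib, ← Finset.mul_sum,
    Finset.sum_comm]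
  congr 1
  refine Finset.sum_congr rfl fun j _ => ?_
  rw [← Finset.mul_sum, Finset.sum_filter]

theorem sum_mul_le_sum_mul_of_layers {ι κ : Type*} [Fintype ι] [Fintype κ] {a : ι → ℕ} {b : κ → ℕ}
    {w : ι → ℝ} {u : κ → ℝ} {g : ℕ → ℝ} (hg : ∀ j, 1 ≤ j → g (j + 1) ≤ g j)
    (ha : ∀ i, 1 ≤ a i) (hb : ∀ i, 1 ≤ b i) (htot : ∑ i, w i = ∑ i, u i)
    (h : ∀ j, ∑ i ∈ Finset.univ.filter (fun i => a i ≤ j), w i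
      ≤ ∑ i ∈ Finset.univ.filter (fun i => b i ≤ j), u i) :
    ∑ i, w i * g (a i) ≤ ∑ i, u i * g (b i) := by
  have hM1 : ∀ i, a i ≤ Finset.univ.sup a + Finset.univ.sup b := fun i =>
    (Finset.le_sup (Finset.mem_univ i)).trans (Nat.le_add_right _ _)
  have hM2 : ∀ i, b i ≤ Finset.univ.sup a + Finset.univ.sup b := fun i =>
    (Finset.le_sup (Finset.mem_univ i)).trans (Nat.le_add_left _ _)
  rw [sum_mul_eq_layer_sum a w g hM1, sum_mul_eq_layer_sum b u g hM2, htot]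
  refine add_le_add_right (Finset.sum_le_sum fun j _ => ?_) _
  rcases Nat.eq_zero_or_pos j with rfl | hj
  · rw [Finset.filter_false_of_mem (fun i _ => by have := ha i; omega),
      Finset.filter_false_of_mem (fun i _ => by have := hb i; omega)]
    simp
  · exact mul_le_mul_of_nonneg_left (h j) (sub_nonneg.2 (hg j hj))

theorem sum_le_sum_of_card_le {α : Type*} {A B : Finset α} {w : α → ℝ} (hw : ∀ x, 0 ≤ w x)
    (hcard : A.card ≤ B.card) (h : ∀ a ∈ A, ∀ b ∈ B, b ∉ A → w a ≤ w b) :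
    ∑ x ∈ A, w x ≤ ∑ x ∈ B, w x := by
  classical
  have hsdiff : ∑ x ∈ A \ B, w x ≤ ∑ x ∈ B \ A, w x := by
    rcases (A \ B).eq_empty_or_nonempty with h0 | h0
    · rw [h0, Finset.sum_empty]
      exact Finset.sum_nonneg fun x _ => hw x
    · obtain ⟨c, hc, hmax⟩ := Finset.exists_max_image (A \ B) w h0
      have hcA := (Finset.mem_sdiff.1 hc).1
      calc ∑ x ∈ A \ B, w x ≤ (A \ B).card • w c := Finset.sum_le_card_nsmul _ _ _ hmax
        _ ≤ (B \ A).card • w c :=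
          nsmul_le_nsmul_left (hw c) (Finset.card_sdiff_le_card_sdiff_iff.2 hcard)
        _ ≤ ∑ x ∈ B \ A, w x := Finset.card_nsmul_le_sum _ _ _ fun x hx =>
          h c hcA x (Finset.mem_sdiff.1 hx).1 (Finset.mem_sdiff.1 hx).2
  rw [← Finset.sum_inter_add_sum_sdiff A B, ← Finset.sum_inter_add_sum_sdiff B A,
    Finset.inter_comm B A]
  gcongr

theorem one_div_natCast_le {m n : ℕ} (hm : 1 ≤ m) (h : m ≤ n) : (1 : ℝ) / n ≤ 1 / m := by
  have : (0 : ℝ) < m := by exact_mod_cast hm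
  have : (m : ℝ) ≤ n := by exact_mod_cast h
  gcongr

/-- The main part of the connective eccentricity index of a tree, see `cei_eq`. -/
noncomputable def ceiMain [Fintype V] (G : SimpleGraph V) : ℝ :=
  ∑ v, ((deg G v : ℝ) - 1) * (1 / (ecc G v : ℝ) + 1 / ((ecc G v + 1 : ℕ) : ℝ))

theorem cei_eq [Fintype V] [DecidableEq V] {G : SimpleGraph V} (hG : G.IsTree) {r : V}
    {par : V → V} (hpar : IsParent G r par) :
    cei G = ceiMain G + (1 / (ecc G r : ℝ) + 1 / ((ecc G r + 1 : ℕ) : ℝ)) +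
      ∑ v ∈ Finset.univ.erase r, (1 / (ecc G v : ℝ) - 1 / ((ecc G (par v) + 1 : ℕ) : ℝ)) := by
  have h1 := hpar.sum_comp hG (fun v => 1 / ((ecc G v + 1 : ℕ) : ℝ))
  have h2 := Finset.add_sum_erase Finset.univ (fun v => 1 / (ecc G v : ℝ)) (Finset.mem_univ r)
  have h3 : cei G = ∑ v, ((deg G v : ℝ) - 1) * (1 / (ecc G v : ℝ)) + ∑ v, 1 / (ecc G v : ℝ) := by
    unfold cei
    rw [← Finset.sum_add_distrib]
    exact Finset.sum_congr rfl fun v _ => by ring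
  have h4 : ceiMain G = ∑ v, ((deg G v : ℝ) - 1) * (1 / (ecc G v : ℝ)) +
      ∑ v, ((deg G v : ℝ) - 1) * (1 / ((ecc G v + 1 : ℕ) : ℝ)) := by
    unfold ceiMain
    rw [← Finset.sum_add_distrib]
    exact Finset.sum_congr rfl fun v _ => by ring
  rw [Finset.sum_sub_distrib]
  linarith

theorem one_div_ecc_parent_le [Fintype V] [Nontrivial V] {G : SimpleGraph V} (hG : G.IsTree)
    {r : V} {par : V → V} (hpar : IsParent G r par) {v : V} (hv : v ≠ r) :
    0 ≤ 1 / (ecc G v : ℝ) - 1 / ((ecc G (par v) + 1 : ℕ) : ℝ) :=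
  sub_nonneg.2 (one_div_natCast_le (ecc_pos hG.connected v)
    (ecc_le_ecc_add_one hG.connected (hpar v hv).1))

theorem ceiMain_add_le_cei [Fintype V] [Nontrivial V] {G : SimpleGraph V} (hG : G.IsTree) (r : V) :
    ceiMain G + (1 / (ecc G r : ℝ) + 1 / ((ecc G r + 1 : ℕ) : ℝ)) ≤ cei G := by
  classical
  obtain ⟨par, hpar⟩ := exists_isParent hG r
  rw [cei_eq hG hpar]
  exact le_add_of_nonneg_right (Finset.sum_nonneg fun v hv =>
    one_div_ecc_parent_le hG hpar (Finset.ne_of_mem_erase hv))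

theorem ceiMain_add_le_cei_of_ne [Fintype V] [Nontrivial V] {G : SimpleGraph V} (hG : G.IsTree)
    {r v : V} (hr : ∀ u, ecc G r ≤ ecc G u) (hv : v ≠ r) :
    ceiMain G + (1 / (ecc G r : ℝ) + 1 / (ecc G v : ℝ)) ≤ cei G := by
  classical
  obtain ⟨par, hpar⟩ := exists_isParent hG r
  rw [cei_eq hG hpar]
  have h1 := Finset.single_le_sum (f := fun v =>
      1 / (ecc G v : ℝ) - 1 / ((ecc G (par v) + 1 : ℕ) : ℝ))
    (fun v hv => one_div_ecc_parent_le hG hpar (Finset.ne_of_mem_erase hv))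
    (Finset.mem_erase.2 ⟨hv, Finset.mem_univ v⟩)
  have h2 := one_div_natCast_le (Nat.le_add_left 1 (ecc G r))
    (Nat.add_le_add_right (hr (par v)) 1)
  linarith

/-- The spine `p 0, …, p (k - 1)` of a caterpillar: all internal vertices, in path order. -/
structure IsSpine [Fintype V] (G : SimpleGraph V) (k : ℕ) (p : ℕ → V) : Prop where
  inj : ∀ i j, i < k → j < k → p i = p j → i = j
  adj : ∀ i, i + 1 < k → G.Adj (p i) (p (i + 1))
  deg_eq_one : ∀ v, (∀ i, i < k → p i ≠ v) → deg G v = 1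
  two_le_deg : ∀ i, i < k → 2 ≤ deg G (p i)

theorem exists_adj_of_deg_eq_one [Fintype V] {G : SimpleGraph V} {v : V} (h : deg G v = 1) :
    ∃ u, G.Adj v u := by
  classical
  unfold deg at h
  obtain ⟨u, hu⟩ := Finset.card_pos.1 (h.symm ▸ Nat.one_pos)
  exact ⟨u, (Finset.mem_filter.1 hu).2⟩

namespace IsSpine

variable [Fintype V] {G : SimpleGraph V} {k : ℕ} {p : ℕ → V}

theorem dist_add (hp : IsSpine G k p) (hG : G.IsTree) (i : ℕ) :
    ∀ m, i + m < k → G.dist (p i) (p (i + m)) = m := by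
  intro m
  induction m using Nat.strong_induction_on with
  | _ m ih =>
    intro hm
    match m, ih, hm with
    | 0, _, _ => simp
    | 1, _, hm => exact dist_eq_one_iff_adj.2 (hp.adj i hm)
    | m + 2, ih, hm =>
      have h1 := ih m (by omega) (by omega)
      have h2 := ih (m + 1) (by omega) (by omega)
      have a1 := hp.adj (i + m) (by omega)
      have a2 := hp.adj (i + (m + 1)) (by omega)
      rcases hG.dist_eq_dist_add_one_of_adj (p i) a2 with h | h
      · have := closer_neighbor_unique hG (p i) a2 a1.symm h (by omega)
        have := hp.inj _ _ (by omega) (by omega) this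
        omega
      · change G.dist (p i) (p (i + (m + 1) + 1)) = _
        omega

theorem dist_eq (hp : IsSpine G k p) (hG : G.IsTree) {i j : ℕ} (hi : i < k) (hj : j < k) :
    G.dist (p i) (p j) = (i - j) + (j - i) := by
  rcases le_total i j with h | h
  · obtain ⟨m, rfl⟩ := Nat.exists_eq_add_of_le h
    rw [hp.dist_add hG i m hj]
    omega
  · obtain ⟨m, rfl⟩ := Nat.exists_eq_add_of_le h
    rw [dist_comm, hp.dist_add hG j m hi]
    omega

theorem exists_adj_of_leaf (hp : IsSpine G k p) (hG : G.IsTree) (hn : 3 ≤ Fintype.card V) {v : V}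
    (hv : deg G v = 1) : ∃ i, i < k ∧ G.Adj v (p i) := by
  obtain ⟨u, hu⟩ := exists_adj_of_deg_eq_one hv
  by_contra hcon
  push Not at hcon
  have hu1 : deg G u = 1 := hp.deg_eq_one u fun i hi h => hcon i hi (h ▸ hu)
  have h1 := ecc_leaf hG hn hv hu
  have h2 := ecc_leaf hG hn hu1 hu.symm
  omega

theorem exists_leaf_adj (hp : IsSpine G k p) (hG : G.IsTree) {i : ℕ} (hi : i < k)
    (hend : i = 0 ∨ i = k - 1) : ∃ v, deg G v = 1 ∧ G.Adj v (p i) := by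
  obtain ⟨a, b, ha, hb, hab⟩ := two_le_deg_iff.1 (hp.two_le_deg i hi)
  by_contra hcon
  push Not at hcon
  have key : ∀ c, G.Adj (p i) c → ∃ j, j < k ∧ p j = c ∧ (i - j) + (j - i) = 1 := by
    intro c hc
    by_contra hcon'
    push Not at hcon'
    refine hcon c (hp.deg_eq_one c fun j hj h => hcon' j hj h ?_) hc.symm
    rw [← hp.dist_eq hG hi hj, h]
    exact dist_eq_one_iff_adj.2 hc
  obtain ⟨j, hj, rfl, hj'⟩ := key a ha
  obtain ⟨l, hl, rfl, hl'⟩ := key b hb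
  exact hab (congrArg p (by omega))

theorem ecc_eq (hp : IsSpine G k p) (hG : G.IsTree) (hn : 3 ≤ Fintype.card V) {i : ℕ}
    (hi : i < k) : ecc G (p i) = max i (k - 1 - i) + 1 := by
  have hne : ∀ v, deg G v = 1 → p i ≠ v := by
    rintro v hv rfl
    have := hp.two_le_deg i hi
    omega
  apply le_antisymm
  · obtain ⟨w, hw⟩ := exists_dist_eq_ecc G (p i)
    by_cases hwp : ∃ j, j < k ∧ p j = w
    · obtain ⟨j, hj, rfl⟩ := hwp
      have := hp.dist_eq hG hi hj
      omega
    · have hw1 : deg G w = 1 := hp.deg_eq_one w fun j hj h => hwp ⟨j, hj, h⟩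
      obtain ⟨j, hj, hadj⟩ := hp.exists_adj_of_leaf hG hn hw1
      have h1 := dist_leaf hG hw1 hadj (hne w hw1)
      have h2 := hp.dist_eq hG hi hj
      omega
  · obtain ⟨a, ha, haadj⟩ := hp.exists_leaf_adj hG (i := 0) (by omega) (Or.inl rfl)
    obtain ⟨b, hb, hbadj⟩ := hp.exists_leaf_adj hG (i := k - 1) (by omega) (Or.inr rfl)
    have h1 := dist_leaf hG ha haadj (hne a ha)
    have h2 := dist_leaf hG hb hbadj (hne b hb)
    have h3 := hp.dist_eq hG hi (j := 0) (by omega)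
    have h4 := hp.dist_eq hG hi (j := k - 1) (by omega)
    have h5 := dist_le_ecc G (p i) a
    have h6 := dist_le_ecc G (p i) b
    omega

theorem pos (hp : IsSpine G k p) (hG : G.IsTree) (hn : 3 ≤ Fintype.card V) : 1 ≤ k := by
  by_contra hk
  obtain ⟨v⟩ := hG.connected.nonempty
  have hv : deg G v = 1 := hp.deg_eq_one v fun i hi => by omega
  obtain ⟨i, hi, -⟩ := hp.exists_adj_of_leaf hG hn hv
  omega

theorem two_le_deg_iff_exists (hp : IsSpine G k p) {v : V} :
    2 ≤ deg G v ↔ ∃ i, i < k ∧ p i = v := by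
  refine ⟨fun h => ?_, ?_⟩
  · by_contra hcon
    have := hp.deg_eq_one v fun i hi h' => hcon ⟨i, hi, h'⟩
    omega
  · rintro ⟨i, hi, rfl⟩
    exact hp.two_le_deg i hi

theorem card_internal (hp : IsSpine G k p) :
    (Finset.univ.filter (fun v => 2 ≤ deg G v)).card = k := by
  classical
  have : Finset.univ.filter (fun v => 2 ≤ deg G v) = (Finset.range k).image p := by
    ext v
    simp [hp.two_le_deg_iff_exists]
  rw [this, Finset.card_image_of_injOn, Finset.card_range]
  intro x hx y hy h
  simp only [Finset.coe_range, Set.mem_Iio] at hx hy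
  exact hp.inj x y hx hy h

theorem card_internal_ecc_le (hp : IsSpine G k p) (hG : G.IsTree) (hn : 3 ≤ Fintype.card V)
    (j : ℕ) :
    (Finset.univ.filter (fun v => 2 ≤ deg G v ∧ ecc G v ≤ j)).card ≤ min k (2 * j - k) := by
  classical
  have : Finset.univ.filter (fun v => 2 ≤ deg G v ∧ ecc G v ≤ j) ⊆
      (Finset.Ico (k - j) (min k j)).image p := by
    intro v hv
    obtain ⟨h1, h2⟩ := (Finset.mem_filter.1 hv).2
    obtain ⟨i, hi, rfl⟩ := hp.two_le_deg_iff_exists.1 h1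
    rw [hp.ecc_eq hG hn hi] at h2
    exact Finset.mem_image_of_mem p (Finset.mem_Ico.2 (by omega))
  refine (Finset.card_le_card this).trans (Finset.card_image_le.trans ?_)
  rw [Nat.card_Ico]
  omega

theorem ecc_parent_add_one_le (hp : IsSpine G k p) (hG : G.IsTree) (hn : 3 ≤ Fintype.card V)
    {par : V → V} (hpar : IsParent G (p (k / 2)) par) {v : V} (hv : v ≠ p (k / 2))
    (hv' : k % 2 = 1 ∨ v ≠ p (k / 2 - 1)) : ecc G (par v) + 1 ≤ ecc G v := by
  have hk := hp.pos hG hn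
  by_cases hvp : ∃ i, i < k ∧ p i = v
  · obtain ⟨i, hi, rfl⟩ := hvp
    have hne : i ≠ k / 2 := fun h => hv (congrArg p h)
    have hne' : k % 2 = 1 ∨ i ≠ k / 2 - 1 := hv'.imp_right fun h h' => h (congrArg p h')
    obtain ⟨j, hj, hadj, hlt⟩ : ∃ j, j < k ∧ G.Adj (p i) (p j) ∧
        ((i < k / 2 ∧ j = i + 1) ∨ (k / 2 < i ∧ j + 1 = i)) := by
      rcases lt_or_gt_of_ne hne with h | h
      · exact ⟨i + 1, by omega, hp.adj i (by omega), by omega⟩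
      · obtain ⟨j, rfl⟩ : ∃ j, i = j + 1 := ⟨i - 1, by omega⟩
        exact ⟨j, by omega, (hp.adj j hi).symm, by omega⟩
    have hd1 := hp.dist_eq hG (i := k / 2) (j := i) (by omega) hi
    have hd2 := hp.dist_eq hG (i := k / 2) (j := j) (by omega) hj
    rw [hpar.eq_of_dist hG hadj (by omega), hp.ecc_eq hG hn hi, hp.ecc_eq hG hn hj]
    omega
  · have hv1 : deg G v = 1 := hp.deg_eq_one v fun i hi h => hvp ⟨i, hi, h⟩
    exact (ecc_leaf hG hn hv1 (hpar v hv).1).ge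

theorem ecc_center (hp : IsSpine G k p) (hG : G.IsTree) (hn : 3 ≤ Fintype.card V) :
    ecc G (p (k / 2)) = k / 2 + 1 := by
  have hk := hp.pos hG hn
  rw [hp.ecc_eq hG hn (by omega)]
  omega

theorem cei_le_of_odd (hp : IsSpine G k p) (hG : G.IsTree) (hn : 3 ≤ Fintype.card V)
    (hk : k % 2 = 1) :
    cei G ≤ ceiMain G + (1 / ((k / 2 + 1 : ℕ) : ℝ) + 1 / ((k / 2 + 1 + 1 : ℕ) : ℝ)) := by
  classical
  obtain ⟨par, hpar⟩ := exists_isParent hG (p (k / 2))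
  rw [cei_eq hG hpar, hp.ecc_center hG hn]
  refine add_le_of_nonpos_right (Finset.sum_nonpos fun v hv => sub_nonpos.2 ?_)
  exact one_div_natCast_le (Nat.le_add_left 1 _)
    (hp.ecc_parent_add_one_le hG hn hpar (Finset.ne_of_mem_erase hv) (Or.inl hk))

theorem cei_le_of_even (hp : IsSpine G k p) (hG : G.IsTree) (hn : 3 ≤ Fintype.card V)
    (hk : k % 2 = 0) :
    cei G ≤ ceiMain G + (1 / ((k / 2 + 1 : ℕ) : ℝ) + 1 / ((k / 2 + 1 : ℕ) : ℝ)) := by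
  classical
  have hk1 := hp.pos hG hn
  obtain ⟨par, hpar⟩ := exists_isParent hG (p (k / 2))
  have hne : p (k / 2 - 1) ≠ p (k / 2) := fun h => by
    have := hp.inj _ _ (by omega) (by omega) h
    omega
  have hadj := hp.adj (k / 2 - 1) (by omega)
  rw [Nat.sub_add_cancel (by omega)] at hadj
  have hpareq : par (p (k / 2 - 1)) = p (k / 2) :=
    hpar.eq_of_dist hG hadj (by rw [dist_self, dist_eq_one_iff_adj.2 hadj.symm])
  have hecc : ecc G (p (k / 2 - 1)) = k / 2 + 1 := by
    rw [hp.ecc_eq hG hn (by omega)]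
    omega
  rw [cei_eq hG hpar, ← Finset.add_sum_erase _ _ (Finset.mem_erase.2 ⟨hne, Finset.mem_univ _⟩),
    hpareq, hp.ecc_center hG hn, hecc]
  have hrest : ∑ v ∈ (Finset.univ.erase (p (k / 2))).erase (p (k / 2 - 1)),
      (1 / (ecc G v : ℝ) - 1 / ((ecc G (par v) + 1 : ℕ) : ℝ)) ≤ 0 := by
    refine Finset.sum_nonpos fun v hv => sub_nonpos.2 ?_
    rw [Finset.mem_erase, Finset.mem_erase] at hv
    exact one_div_natCast_le (Nat.le_add_left 1 _)
      (hp.ecc_parent_add_one_le hG hn hpar hv.2.1 (Or.inr hv.1))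
  linarith

end IsSpine

theorem one_le_deg [Fintype V] [Nontrivial V] {G : SimpleGraph V} (hG : G.Connected) (v : V) :
    1 ≤ deg G v := by
  classical
  obtain ⟨u, hu⟩ := hG.preconnected.exists_adj_of_nontrivial v
  exact Finset.card_pos.2 ⟨u, Finset.mem_filter.2 ⟨Finset.mem_univ u, hu⟩⟩

theorem sum_deg_sub_one_filter_ecc [Fintype V] [Nontrivial V] {G : SimpleGraph V}
    (hG : G.Connected) (j : ℕ) :
    ∑ v ∈ Finset.univ.filter (fun v => ecc G v ≤ j), ((deg G v : ℝ) - 1)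
      = ∑ v ∈ Finset.univ.filter (fun v => 2 ≤ deg G v ∧ ecc G v ≤ j), ((deg G v : ℝ) - 1) := by
  symm
  refine Finset.sum_subset (fun v hv => ?_) fun v hv hv' => ?_
  · exact Finset.mem_filter.2 ⟨Finset.mem_univ v, (Finset.mem_filter.1 hv).2.2⟩
  · simp only [Finset.mem_filter, Finset.mem_univ, true_and] at hv hv'
    have h1 := one_le_deg hG v
    have h2 : deg G v = 1 := by
      by_contra h
      exact hv' ⟨by omega, hv⟩
    rw [h2]
    norm_num

theorem card_internal_congr {W : Type*} [Fintype V] [Fintype W] {G : SimpleGraph V}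
    {H : SimpleGraph W} (σ : W ≃ V) (hσ : ∀ w, deg G (σ w) = deg H w) :
    (Finset.univ.filter (fun w => 2 ≤ deg H w)).card
      = (Finset.univ.filter (fun v => 2 ≤ deg G v)).card := by
  rw [← Finset.card_map σ.toEmbedding]
  congr 1
  ext v
  simp only [Finset.mem_map_equiv, Finset.mem_filter, Finset.mem_univ, true_and, ← hσ,
    Equiv.apply_symm_apply]

/-- A caterpillar whose degrees do not decrease away from the center minimizes the main part of the
connective eccentricity index among trees with the same degrees. -/
theorem IsSpine.ceiMain_le {W : Type*} [Fintype V] [Fintype W] {G : SimpleGraph V}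
    {H : SimpleGraph W} {k : ℕ} {p : ℕ → V} (hp : IsSpine G k p) (hG : G.IsTree) (hH : H.IsTree)
    (hn : 3 ≤ Fintype.card V) (σ : W ≃ V) (hσ : ∀ w, deg G (σ w) = deg H w)
    (hgreedy : ∀ i j, i < k → j < k → max j (k - 1 - j) < max i (k - 1 - i) →
      deg G (p j) ≤ deg G (p i)) :
    ceiMain G ≤ ceiMain H := by
  classical
  have : Nontrivial V := Fintype.one_lt_card_iff_nontrivial.1 (by omega)
  have : Nontrivial W := σ.nontrivial
  have hcardH := (card_internal_congr σ hσ).trans hp.card_internal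
  refine sum_mul_le_sum_mul_of_layers (a := ecc G) (b := ecc H)
    (g := fun e : ℕ => 1 / (e : ℝ) + 1 / ((e + 1 : ℕ) : ℝ)) ?_ (ecc_pos hG.connected)
    (ecc_pos hH.connected) ?_ ?_
  · intro j hj
    exact add_le_add (one_div_natCast_le hj (by omega)) (one_div_natCast_le (by omega) (by omega))
  · rw [← Equiv.sum_comp σ]
    simp only [hσ]
  · intro j
    rw [sum_deg_sub_one_filter_ecc hG.connected, sum_deg_sub_one_filter_ecc hH.connected]
    have hmap : ∑ w ∈ Finset.univ.filter (fun w => 2 ≤ deg H w ∧ ecc H w ≤ j), ((deg H w : ℝ) - 1)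
        = ∑ v ∈ (Finset.univ.filter (fun w => 2 ≤ deg H w ∧ ecc H w ≤ j)).map σ.toEmbedding,
          ((deg G v : ℝ) - 1) := by
      rw [Finset.sum_map]
      exact Finset.sum_congr rfl fun w _ => by rw [Equiv.coe_toEmbedding, hσ]
    rw [hmap]
    refine sum_le_sum_of_card_le (fun v => ?_) ?_ ?_
    · have := one_le_deg hG.connected v
      rw [sub_nonneg]
      exact_mod_cast this
    · rw [Finset.card_map]
      exact (hp.card_internal_ecc_le hG hn j).trans (_root_.card_internal_ecc_le hH hcardH j)
    · intro a ha b hb hba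
      obtain ⟨w, hw, rfl⟩ := Finset.mem_map.1 hb
      obtain ⟨hw1, -⟩ := (Finset.mem_filter.1 hw).2
      rw [Equiv.coe_toEmbedding] at hba ⊢
      rw [← hσ] at hw1
      obtain ⟨ha1, ha2⟩ := (Finset.mem_filter.1 ha).2
      have hb2 : ¬ ecc G (σ w) ≤ j := fun h =>
        hba (Finset.mem_filter.2 ⟨Finset.mem_univ _, hw1, h⟩)
      obtain ⟨i, hi, rfl⟩ := hp.two_le_deg_iff_exists.1 ha1
      obtain ⟨l, hl, hlw⟩ := hp.two_le_deg_iff_exists.1 hw1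
      rw [← hlw] at hb2 ⊢
      rw [hp.ecc_eq hG hn hi] at ha2
      rw [hp.ecc_eq hG hn hl] at hb2
      have := hgreedy l i hl hi (by omega)
      gcongr

/-- A greedy caterpillar has a spine along which the degrees do not decrease away from the
center. -/
theorem IsGreedyCaterpillar.exists_isSpine [Fintype V] [Nonempty V] {G : SimpleGraph V} {k : ℕ}
    (h : IsGreedyCaterpillar G k) : ∃ p, IsSpine G k p ∧
      ∀ i j, i < k → j < k → max j (k - 1 - j) < max i (k - 1 - i) →
        deg G (p j) ≤ deg G (p i) := by
  obtain ⟨z, hadj, hleaf, hdeg, hgreedy⟩ := h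
  let p : ℕ → V := fun i => if h : i < k then z ⟨i, h⟩ else Classical.arbitrary V
  have hpz : ∀ i (h : i < k), p i = z ⟨i, h⟩ := fun i h => dif_pos h
  refine ⟨p, ⟨?_, ?_, ?_, ?_⟩, ?_⟩
  · intro i j hi hj hij
    rw [hpz i hi, hpz j hj] at hij
    exact congrArg Fin.val (z.injective hij)
  · intro i hi
    rw [hpz i (by omega), hpz (i + 1) hi]
    exact hadj i hi
  · intro v hv
    refine hleaf v ?_
    rintro ⟨i, rfl⟩
    exact hv i i.2 (hpz i i.2)
  · intro i hi
    rw [hpz i hi]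
    exact hdeg _
  · intro i j hi hj hij
    rw [hpz i hi, hpz j hj]
    exact hgreedy ⟨i, hi⟩ ⟨j, hj⟩ hij

/-- among all trees with a given tree degree sequence, a greedy
caterpillar attains the minimum connective eccentricity index. -/
theorem cei_greedyCaterpillar_min {n k : ℕ} (hn : 3 ≤ n) (d : Fin n → ℕ)
    (hpos : ∀ i, 1 ≤ d i) (hmono : ∀ i j : Fin n, i ≤ j → d j ≤ d i)
    (hsum : ∑ i, d i = 2 * (n - 1))
    (hk : ∀ i : Fin n, 1 < d i ↔ (i : ℕ) < k)
    {W : Type*} [Fintype V] [Fintype W]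
    (Tstar : SimpleGraph V) (hTstar : Tstar.IsTree) (hdstar : hasDegSeq Tstar d)
    (hgreedy : IsGreedyCaterpillar Tstar k)
    (T : SimpleGraph W) (hT : T.IsTree) (hd : hasDegSeq T d) :
    cei Tstar ≤ cei T := by
  obtain ⟨e₁, he₁⟩ := hdstar
  obtain ⟨e₂, he₂⟩ := hd
  have hcard : 3 ≤ Fintype.card V := by rwa [Fintype.card_congr e₁, Fintype.card_fin]
  let σ : W ≃ V := e₂.trans e₁.symm
  have hσ : ∀ w, deg Tstar (σ w) = deg T w := fun w => by simp [σ, he₁, he₂]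
  have : Nontrivial V := Fintype.one_lt_card_iff_nontrivial.1 (by omega)
  have : Nontrivial W := σ.nontrivial
  obtain ⟨p, hp, hmonotone⟩ := hgreedy.exists_isSpine
  have hmain := hp.ceiMain_le hTstar hT hcard σ hσ hmonotone
  have hcardT := (card_internal_congr σ hσ).trans hp.card_internal
  have hcount := card_internal_ecc_le hT hcardT (k / 2 + 1)
  have hk1 := hp.pos hTstar hcard
  obtain ⟨r, -, hr⟩ := Finset.exists_min_image Finset.univ (ecc T) Finset.univ_nonempty
  have hr' : ∀ u, ecc T r ≤ ecc T u := fun u => hr u (Finset.mem_univ u)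
  rcases Nat.mod_two_eq_zero_or_one k with hk2 | hk2
  · obtain ⟨v, hv, hvr⟩ := Finset.exists_mem_ne
      (lt_of_lt_of_le (by omega : 1 < min k (2 * (k / 2 + 1) - k)) hcount) r
    have hv2 := (Finset.mem_filter.1 hv).2.2
    have h1 := hp.cei_le_of_even hTstar hcard hk2
    have h2 := ceiMain_add_le_cei_of_ne hT hr' hvr
    have h3 := one_div_natCast_le (ecc_pos hT.connected v) hv2
    have h4 := one_div_natCast_le (ecc_pos hT.connected r) ((hr' v).trans hv2)
    linarith
  · obtain ⟨v, hv⟩ := Finset.card_pos.1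
      (lt_of_lt_of_le (by omega : 0 < min k (2 * (k / 2 + 1) - k)) hcount)
    have hv2 := (Finset.mem_filter.1 hv).2.2
    have h1 := hp.cei_le_of_odd hTstar hcard hk2
    have h2 := ceiMain_add_le_cei hT v
    have h3 := one_div_natCast_le (ecc_pos hT.connected v) hv2
    have h4 := one_div_natCast_le (Nat.le_add_left 1 (ecc T v)) (Nat.add_le_add_right hv2 1)
    linarith
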